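/- Let m ≥ 2, let E := EuclideanSpace ℝ (Fin m), let σ be the uniform (rotation-invariant) probability measure on the unit sphere {x ∈ E : ‖x‖ = 1}, let a ∈ E with ‖a‖ = 1, and let τ ∈ [0, 1]. Then σ {u : τ ≤ |⟪u, a⟫|} = (∫_{0}^{1-τ²} t^{(m-3)/2} (1-t)^{-1/2} dt) / (Real.Gamma ((m-1)/2) * Real.Gamma (1/2) / Real.Gamma (m/2)). (Lemma 2: the boundary-crossing probability of a uniformly sampled unit direction against a linearized boundary with effective threshold τ equals the regularized incomplete beta value I_{1−τ²}((m−1)/2, 1/2).) -/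

import Mathlib

open scoped InnerProductSpace
open MeasureTheory

/-- The restriction of a linear isometry equivalence of `E` to the unit sphere. -/
noncomputable def sphereMap {E : Type*} [NormedAddCommGroup E] [InnerProductSpace ℝ E]
    (f : E ≃ₗᵢ[ℝ] E) (u : Metric.sphere (0 : E) 1) : Metric.sphere (0 : E) 1 :=
  ⟨f u, by
    have hu := u.2
    simp only [Metric.mem_sphere, dist_zero_right] at hu ⊢
    rw [f.norm_map]
    exact hu⟩

open Set in
/-- Integral of a radial function in polar coordinates, for the Lebesgue integral. -/
theorem lintegral_fun_norm_addHaar {E : Type*} [NormedAddCommGroup E] [NormedSpace ℝ E]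
    [MeasurableSpace E] [Nontrivial E] [FiniteDimensional ℝ E] [BorelSpace E]
    (μ : Measure E) [μ.IsAddHaarMeasure] {f : ℝ → ENNReal} (hf : Measurable f) :
    ∫⁻ x, f ‖x‖ ∂μ = μ.toSphere univ *
      ∫⁻ y in Ioi (0 : ℝ), ENNReal.ofReal (y ^ (Module.finrank ℝ E - 1)) * f y :=
  calc
    ∫⁻ x, f ‖x‖ ∂μ = ∫⁻ x : ({(0)}ᶜ : Set E), f (‖x.1‖) ∂(μ.comap (↑)) := by
      rw [lintegral_subtype_comap (measurableSet_singleton _).compl fun x ↦ f (‖x‖),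
        restrict_compl_singleton]
    _ = ∫⁻ x, f x.2 ∂μ.toSphere.prod (.volumeIoiPow (Module.finrank ℝ E - 1)) := by
      simpa using μ.measurePreserving_homeomorphUnitSphereProd.lintegral_comp_emb
        (Homeomorph.measurableEmbedding _) (f ∘ Subtype.val ∘ Prod.snd)
    _ = μ.toSphere univ *
        ∫⁻ x : Ioi (0 : ℝ), f x ∂.volumeIoiPow (Module.finrank ℝ E - 1) := by
      rw [lintegral_prod _ (by fun_prop)]
      simp [mul_comm]
    _ = _ := by
      rw [Measure.volumeIoiPow, lintegral_withDensity_eq_lintegral_mul _ (by fun_prop)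
        (by fun_prop)]
      simp only [Pi.mul_apply]
      rw [lintegral_subtype_comap measurableSet_Ioi
        fun a ↦ ENNReal.ofReal (a ^ (Module.finrank ℝ E - 1)) * f a]

theorem lintegral_abs_pow_indicator_scale (n : ℕ) {c : ℝ} (hc : 0 < c) :
    ∫⁻ x : ℝ, ENNReal.ofReal (|x| ^ n) * {x : ℝ | x ^ 2 * c < 1}.indicator 1 x =
      ENNReal.ofReal ((√c ^ (n + 1))⁻¹) *
        ∫⁻ x : ℝ, ENNReal.ofReal (|x| ^ n) * {x : ℝ | x ^ 2 < 1}.indicator 1 x := by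
  have hs : 0 < √c := Real.sqrt_pos.2 hc
  have hg : Measurable fun x : ℝ ↦
      ENNReal.ofReal (|x| ^ n) * {x : ℝ | x ^ 2 < 1}.indicator (1 : ℝ → ENNReal) x :=
    Measurable.mul (by fun_prop)
      (measurable_one.indicator (measurableSet_lt (by fun_prop) (by fun_prop)))
  have h := congrArg (fun μ : Measure ℝ ↦ ∫⁻ x, ENNReal.ofReal (|x| ^ n) *
    {x : ℝ | x ^ 2 < 1}.indicator 1 x ∂μ) (Measure.map_addHaar_smul (volume : Measure ℝ) hs.ne')
  simp only [lintegral_smul_measure] at h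
  rw [lintegral_map hg (by fun_prop)] at h
  rw [pow_succ, mul_inv, ENNReal.ofReal_mul (by positivity), mul_assoc]
  simp only [Module.finrank_self, pow_one, abs_of_pos (inv_pos.2 hs), smul_eq_mul] at h
  rw [← h, ← lintegral_const_mul' _ _ ENNReal.ofReal_ne_top]
  refine lintegral_congr fun x ↦ ?_
  have e : x ∈ {x : ℝ | x ^ 2 * c < 1} ↔ √c * x ∈ {x : ℝ | x ^ 2 < 1} := by
    rw [Set.mem_ofPred_eq, Set.mem_ofPred_eq, mul_pow, Real.sq_sqrt hc.le, mul_comm]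
  rw [abs_mul, abs_of_pos hs, mul_pow, ENNReal.ofReal_mul (by positivity), ← mul_assoc,
    ← mul_assoc, ← ENNReal.ofReal_mul (by positivity), inv_mul_cancel₀ (by positivity)]
  simp only [Set.indicator, e]
  simp

/-- The slice of a cone over a cap at height `x`, rescaled to height one. -/
theorem volume_cone_slice (n : ℕ) (τ : ℝ) {x : ℝ} (hx : x ≠ 0) :
    volume {y : EuclideanSpace ℝ (Fin n) |
        x ^ 2 + ‖y‖ ^ 2 < 1 ∧ τ ^ 2 * (x ^ 2 + ‖y‖ ^ 2) ≤ x ^ 2} =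
      ENNReal.ofReal (|x| ^ n) * volume {z : EuclideanSpace ℝ (Fin n) |
          x ^ 2 * (1 + ‖z‖ ^ 2) < 1 ∧ τ ^ 2 * (1 + ‖z‖ ^ 2) ≤ 1} := by
  have h := Measure.addHaar_smul (volume : Measure (EuclideanSpace ℝ (Fin n))) x
    {z | x ^ 2 * (1 + ‖z‖ ^ 2) < 1 ∧ τ ^ 2 * (1 + ‖z‖ ^ 2) ≤ 1}
  rw [finrank_euclideanSpace_fin, abs_pow] at h
  rw [← h]
  congr 1
  ext y
  have hx2 : 0 < x ^ 2 := by positivity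
  have e : x ^ 2 * ‖x⁻¹ • y‖ ^ 2 = ‖y‖ ^ 2 := by
    rw [norm_smul, mul_pow, norm_inv, inv_pow, Real.norm_eq_abs, sq_abs, mul_inv_cancel_left₀ hx2.ne']
  rw [Set.mem_smul_set_iff_inv_smul_mem₀ hx]
  simp only [Set.mem_ofPred_eq]
  have e' : x ^ 2 * (1 + ‖x⁻¹ • y‖ ^ 2) = x ^ 2 + ‖y‖ ^ 2 := by rw [mul_add, e, mul_one]
  rw [e', ← mul_le_mul_iff_right₀ hx2 (b := τ ^ 2 * (1 + _)), mul_left_comm, e', mul_one]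

theorem EuclideanSpace.volume_preserving_cons (n : ℕ) :
    MeasurePreserving (fun p : ℝ × EuclideanSpace ℝ (Fin n) ↦
      (WithLp.toLp 2 (Fin.cons p.1 p.2 : Fin (n + 1) → ℝ) : EuclideanSpace ℝ (Fin (n + 1)))) := by
  have h1 := PiLp.volume_preserving_toLp (Fin (n + 1))
  have h2 := (volume_preserving_piFinSuccAbove (fun _ : Fin (n + 1) ↦ ℝ) 0).symm
  have h3 := (MeasurePreserving.id (volume : Measure ℝ)).prod (PiLp.volume_preserving_ofLp (Fin n))
  have h := h1.comp (h2.comp h3)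
  simpa [Function.comp_def, Fin.insertNthEquiv, Prod.map, Measure.volume_eq_prod] using h

theorem measurable_indicator_le_one (τ : ℝ) :
    Measurable ({s : ℝ | τ ^ 2 * (1 + s ^ 2) ≤ 1}.indicator (1 : ℝ → ENNReal)) :=
  measurable_one.indicator (measurableSet_le (by fun_prop) (by fun_prop))

/-- Up to a constant, the part of the unit ball in a double cone about the first axis has volume
given by an integral over the slope of the cone. -/
theorem volume_ball_inter_cone (n : ℕ) [NeZero n] : ∃ K : ENNReal, ∀ τ : ℝ, 0 ≤ τ →
    volume {x : EuclideanSpace ℝ (Fin (n + 1)) | ‖x‖ < 1 ∧ τ * ‖x‖ ≤ |x 0|} =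
      K * ∫⁻ s in Set.Ioi (0 : ℝ), ENNReal.ofReal (s ^ (n - 1) * (√(1 + s ^ 2) ^ (n + 1))⁻¹) *
        {s : ℝ | τ ^ 2 * (1 + s ^ 2) ≤ 1}.indicator 1 s := by
  refine ⟨(∫⁻ x : ℝ, ENNReal.ofReal (|x| ^ n) * {x : ℝ | x ^ 2 < 1}.indicator 1 x) *
    (volume : Measure (EuclideanSpace ℝ (Fin n))).toSphere Set.univ, fun τ hτ ↦ ?_⟩
  have hmS : MeasurableSet
      {x : EuclideanSpace ℝ (Fin (n + 1)) | ‖x‖ < 1 ∧ τ * ‖x‖ ≤ |x 0|} :=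
    measurableSet_setOfPred.2 (Measurable.and
      (measurableSet_setOfPred.1 (measurableSet_lt (by fun_prop) (by fun_prop)))
      (measurableSet_setOfPred.1 (measurableSet_le (by fun_prop) (by fun_prop))))
  have hP := EuclideanSpace.volume_preserving_cons n
  rw [← hP.measure_preimage hmS.nullMeasurableSet, Measure.volume_eq_prod,
    Measure.prod_apply (hP.measurable hmS)]
  have hslice : ∀ x : ℝ, x ≠ 0 →
      volume (Prod.mk x ⁻¹' ((fun p : ℝ × EuclideanSpace ℝ (Fin n) ↦
        (WithLp.toLp 2 (Fin.cons p.1 p.2 : Fin (n + 1) → ℝ) : EuclideanSpace ℝ (Fin (n + 1)))) ⁻¹'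
        {x | ‖x‖ < 1 ∧ τ * ‖x‖ ≤ |x 0|})) =
      ∫⁻ z : EuclideanSpace ℝ (Fin n), ENNReal.ofReal (|x| ^ n) *
        {x : ℝ | x ^ 2 * (1 + ‖z‖ ^ 2) < 1}.indicator 1 x *
        {s : ℝ | τ ^ 2 * (1 + s ^ 2) ≤ 1}.indicator 1 ‖z‖ := by
    intro x hx
    have hm : MeasurableSet {z : EuclideanSpace ℝ (Fin n) |
          x ^ 2 * (1 + ‖z‖ ^ 2) < 1 ∧ τ ^ 2 * (1 + ‖z‖ ^ 2) ≤ 1} :=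
      measurableSet_setOfPred.2 (Measurable.and
        (measurableSet_setOfPred.1 (measurableSet_lt (by fun_prop) (by fun_prop)))
        (measurableSet_setOfPred.1 (measurableSet_le (by fun_prop) (by fun_prop))))
    trans ENNReal.ofReal (|x| ^ n) * volume {z : EuclideanSpace ℝ (Fin n) |
          x ^ 2 * (1 + ‖z‖ ^ 2) < 1 ∧ τ ^ 2 * (1 + ‖z‖ ^ 2) ≤ 1}
    · rw [← volume_cone_slice n τ hx]
      congr 1
      ext y
      have e : ‖(WithLp.toLp 2 (Fin.cons x y : Fin (n + 1) → ℝ) :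
          EuclideanSpace ℝ (Fin (n + 1)))‖ ^ 2 = x ^ 2 + ‖y‖ ^ 2 := by
        simp [EuclideanSpace.norm_sq_eq, Fin.sum_univ_succ]
      simp only [Set.mem_preimage, Set.mem_ofPred_eq, ← e]
      refine and_congr ?_ ?_
      · rw [sq_lt_one_iff₀ (norm_nonneg _)]
      · rw [← mul_pow, sq_le_sq, abs_of_nonneg (by positivity : 0 ≤ τ * _)]
        simp
    · rw [← lintegral_indicator_one hm, ← lintegral_const_mul _ (measurable_one.indicator hm)]
      refine lintegral_congr fun z ↦ ?_
      simp only [Set.indicator, Set.mem_ofPred_eq, Pi.one_apply]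
      split_ifs <;> simp_all
  have hae : ∀ᵐ x : ℝ, x ≠ 0 := Measure.ae_ne volume 0
  rw [lintegral_congr_ae (hae.mono hslice), lintegral_lintegral_swap]
  · have : ∀ z : EuclideanSpace ℝ (Fin n), ∫⁻ x : ℝ, ENNReal.ofReal (|x| ^ n) *
        {x : ℝ | x ^ 2 * (1 + ‖z‖ ^ 2) < 1}.indicator 1 x *
        {s : ℝ | τ ^ 2 * (1 + s ^ 2) ≤ 1}.indicator 1 ‖z‖ =
        (∫⁻ x : ℝ, ENNReal.ofReal (|x| ^ n) * {x : ℝ | x ^ 2 < 1}.indicator 1 x) *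
        (ENNReal.ofReal (√(1 + ‖z‖ ^ 2) ^ (n + 1))⁻¹ *
        {s : ℝ | τ ^ 2 * (1 + s ^ 2) ≤ 1}.indicator 1 ‖z‖) := by
      intro z
      have hm : Measurable ({x : ℝ | x ^ 2 * (1 + ‖z‖ ^ 2) < 1}.indicator (1 : ℝ → ENNReal)) :=
        measurable_one.indicator (measurableSet_lt (by fun_prop) (by fun_prop))
      rw [lintegral_mul_const _ (by fun_prop),
        lintegral_abs_pow_indicator_scale n (by positivity)]
      ring
    simp_rw [this]
    have hI := measurable_indicator_le_one τ
    rw [lintegral_const_mul _ (by fun_prop), lintegral_fun_norm_addHaar volume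
      (f := fun s ↦ ENNReal.ofReal (√(1 + s ^ 2) ^ (n + 1))⁻¹ *
        {s : ℝ | τ ^ 2 * (1 + s ^ 2) ≤ 1}.indicator 1 s) (by fun_prop), mul_assoc]
    congr 2
    refine setLIntegral_congr_fun measurableSet_Ioi fun s hs ↦ ?_
    have hs : 0 < s := hs
    simp only [finrank_euclideanSpace_fin]
    rw [ENNReal.ofReal_mul (by positivity), mul_assoc]
  · have hI := measurable_indicator_le_one τ
    refine (Measurable.mul (Measurable.mul (by fun_prop) ?_) (by fun_prop)).aemeasurable
    exact (measurable_one (α := ENNReal) (β := ℝ × EuclideanSpace ℝ (Fin n))).indicator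
      (s := {p | p.1 ^ 2 * (1 + ‖p.2‖ ^ 2) < 1}) (measurableSet_lt (by fun_prop) (by fun_prop))

theorem image_sq_div_one_add_sq_Ioi :
    (fun s : ℝ ↦ s ^ 2 / (1 + s ^ 2)) '' Set.Ioi 0 = Set.Ioo 0 1 := by
  ext t
  constructor
  · rintro ⟨s, hs, rfl⟩
    have hs : 0 < s := hs
    exact ⟨by positivity, by rw [div_lt_one (by positivity)]; linarith⟩
  · rintro ⟨h0, h1⟩
    have h1' : 0 < 1 - t := by linarith
    refine ⟨√(t / (1 - t)), Real.sqrt_pos.2 (by positivity), ?_⟩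
    simp only
    rw [Real.sq_sqrt (by positivity)]
    field_simp
    ring

theorem deriv_mul_beta_integrand {n : ℕ} (hn : n ≠ 0) {s : ℝ} (hs : 0 < s) :
    |2 * s / (1 + s ^ 2) ^ 2| * ((s ^ 2 / (1 + s ^ 2)) ^ ((((n + 1 : ℕ) : ℝ) - 3) / 2) *
      (1 - s ^ 2 / (1 + s ^ 2)) ^ (-(1 : ℝ) / 2)) =
      2 * (s ^ (n - 1) * (√(1 + s ^ 2) ^ (n + 1))⁻¹) := by
  obtain ⟨k, rfl⟩ := Nat.exists_eq_succ_of_ne_zero hn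
  have hq : 0 < √(1 + s ^ 2) := Real.sqrt_pos.2 (by positivity)
  have hq2 : √(1 + s ^ 2) ^ 2 = 1 + s ^ 2 := Real.sq_sqrt (by positivity)
  have e1 : 1 - s ^ 2 / (1 + s ^ 2) = (√(1 + s ^ 2))⁻¹ ^ 2 := by
    rw [inv_pow, hq2]
    field_simp
    ring
  rw [e1, abs_of_pos (by positivity), ← hq2]
  set q := √(1 + s ^ 2)
  have hp : ∀ {x : ℝ}, 0 < x → ∀ a : ℝ, (x ^ 2) ^ (a / 2) = x ^ a := by
    intro x hx a
    rw [← Real.rpow_natCast, ← Real.rpow_mul hx.le]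
    congr 1
    push_cast
    ring
  have e2 : ((k + 1 + 1 : ℕ) : ℝ) - 3 = (k : ℝ) - 1 := by push_cast; ring
  rw [← div_pow, hp (by positivity), hp (by positivity), Nat.succ_eq_add_one, e2,
    Real.rpow_sub_one (by positivity), Real.rpow_natCast, Real.rpow_neg_one, inv_inv,
    Nat.add_sub_cancel, div_pow, Real.sqrt_sq hq.le]
  field_simp
  ring

theorem lintegral_Ioi_eq_lintegral_beta {n : ℕ} (hn : n ≠ 0) (τ : ℝ) :
    2 * ∫⁻ s in Set.Ioi (0 : ℝ), ENNReal.ofReal (s ^ (n - 1) * (√(1 + s ^ 2) ^ (n + 1))⁻¹) *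
        {s : ℝ | τ ^ 2 * (1 + s ^ 2) ≤ 1}.indicator 1 s =
      ∫⁻ t in Set.Ioo (0 : ℝ) 1, (Set.Iic (1 - τ ^ 2)).indicator (fun t ↦ ENNReal.ofReal
        (t ^ ((((n + 1 : ℕ) : ℝ) - 3) / 2) * (1 - t) ^ (-(1 : ℝ) / 2))) t := by
  rw [← image_sq_div_one_add_sq_Ioi, lintegral_image_eq_lintegral_abs_deriv_mul measurableSet_Ioi
    (f' := fun s ↦ 2 * s / (1 + s ^ 2) ^ 2), ← lintegral_const_mul' _ _ (by simp)]
  · refine setLIntegral_congr_fun measurableSet_Ioi fun s hs ↦ ?_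
    have e : τ ^ 2 * (1 + s ^ 2) ≤ 1 ↔ s ^ 2 / (1 + s ^ 2) ≤ 1 - τ ^ 2 := by
      rw [div_le_iff₀ (by positivity)]
      constructor <;> intro <;> linarith
    simp only [Set.indicator, Set.mem_ofPred_eq, Set.mem_Iic, e, Pi.one_apply]
    split_ifs
    · rw [← ENNReal.ofReal_mul (abs_nonneg _), deriv_mul_beta_integrand hn hs,
        ENNReal.ofReal_mul zero_le_two, mul_one, ENNReal.ofReal_ofNat]
    · simp
  · intro s hs
    have h : HasDerivAt (fun s : ℝ ↦ s ^ 2) (2 * s) s := by simpa using hasDerivAt_pow 2 s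
    have e : 2 * s / (1 + s ^ 2) ^ 2 =
        (2 * s * (1 + s ^ 2) - s ^ 2 * (2 * s)) / (1 + s ^ 2) ^ 2 := by ring
    rw [e]
    exact (h.div (h.const_add 1) (by positivity)).hasDerivWithinAt
  · intro s hs t ht h
    have hs : 0 < s := hs
    have ht : 0 < t := ht
    simp only at h
    rw [div_eq_div_iff (by positivity) (by positivity)] at h
    exact (pow_left_inj₀ hs.le ht.le two_ne_zero).1 (by linarith)

theorem lintegral_beta_integrand {α β : ℝ} (hα : 0 < α) (hβ : 0 < β) :
    ∫⁻ t in Set.Ioo (0 : ℝ) 1, ENNReal.ofReal (t ^ (α - 1) * (1 - t) ^ (β - 1)) =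
      ENNReal.ofReal (ProbabilityTheory.beta α β) := by
  have hB := ProbabilityTheory.beta_pos hα hβ
  have h := ProbabilityTheory.lintegral_betaPDF_eq_one hα hβ
  rw [ProbabilityTheory.lintegral_betaPDF] at h
  simp_rw [mul_assoc, ENNReal.ofReal_mul (one_div_pos.2 hB).le] at h
  rw [lintegral_const_mul' _ _ (by simp)] at h
  rw [← mul_one (ENNReal.ofReal (ProbabilityTheory.beta α β)), ← h, ← mul_assoc,
    ← ENNReal.ofReal_mul hB.le, mul_one_div_cancel hB.ne', ENNReal.ofReal_one, one_mul]

theorem lintegral_beta_integrand_Iic {α β : ℝ} (hα : 0 < α) (hβ : 0 < β) {b : ℝ} (h0 : 0 ≤ b)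
    (h1 : b ≤ 1) :
    ∫⁻ t in Set.Ioo (0 : ℝ) 1, (Set.Iic b).indicator
        (fun t ↦ ENNReal.ofReal (t ^ (α - 1) * (1 - t) ^ (β - 1))) t =
      ENNReal.ofReal (∫ t in (0 : ℝ)..b, t ^ (α - 1) * (1 - t) ^ (β - 1)) := by
  have hsub : Set.Ioo 0 b ⊆ Set.Ioo (0 : ℝ) 1 := Set.Ioo_subset_Ioo_right h1
  have hnn : 0 ≤ᵐ[volume.restrict (Set.Ioo (0 : ℝ) b)]
      fun t ↦ t ^ (α - 1) * (1 - t) ^ (β - 1) := by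
    refine ae_restrict_of_forall_mem measurableSet_Ioo fun t ht ↦ ?_
    exact mul_nonneg (Real.rpow_nonneg ht.1.le _) (Real.rpow_nonneg (by linarith [(hsub ht).2]) _)
  have hint : IntegrableOn (fun t : ℝ ↦ t ^ (α - 1) * (1 - t) ^ (β - 1)) (Set.Ioo 0 b) := by
    refine ⟨Measurable.aestronglyMeasurable (by fun_prop), ?_⟩
    rw [hasFiniteIntegral_iff_ofReal hnn]
    refine (lintegral_mono_set hsub).trans_lt ?_
    rw [lintegral_beta_integrand hα hβ]
    exact ENNReal.ofReal_lt_top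
  rw [intervalIntegral.integral_of_le h0, integral_Ioc_eq_integral_Ioo,
    ofReal_integral_eq_lintegral_ofReal hint hnn, lintegral_indicator measurableSet_Iic,
    Measure.restrict_restrict measurableSet_Iic]
  refine setLIntegral_congr ?_
  have : (Set.Iic b ∩ Set.Ioo 0 1 : Set ℝ) =ᵐ[volume] (Set.Iio b ∩ Set.Ioo 0 1 : Set ℝ) :=
    ae_eq_set_inter Iio_ae_eq_Iic.symm (ae_eq_refl _)
  have e : (Set.Iio b ∩ Set.Ioo 0 1 : Set ℝ) = Set.Ioo 0 b := by
    ext t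
    simp only [Set.mem_inter_iff, Set.mem_Iio, Set.mem_Ioo]
    exact ⟨fun h ↦ ⟨h.2.1, h.1⟩, fun h ↦ ⟨h.2, h.1, h.2.trans_le h1⟩⟩
  rwa [e] at this

section Rotation

variable {E : Type*} [NormedAddCommGroup E] [InnerProductSpace ℝ E]

theorem exists_linearIsometryEquiv_apply_eq {v w : E} (h : ‖v‖ = ‖w‖) :
    ∃ f : E ≃ₗᵢ[ℝ] E, f v = w :=
  ⟨_, Submodule.reflection_sub h⟩

variable [MeasurableSpace E] [BorelSpace E]

theorem measurable_sphereMap (f : E ≃ₗᵢ[ℝ] E) : Measurable (sphereMap f) :=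
  (f.continuous.measurable.comp measurable_subtype_coe).subtype_mk

variable [FiniteDimensional ℝ E]

theorem measurableSet_abs_inner_ge (τ : ℝ) (a : E) :
    MeasurableSet {u : Metric.sphere (0 : E) 1 | τ ≤ |⟪(u : E), a⟫_ℝ|} :=
  measurableSet_le (by fun_prop) (by fun_prop)

/-- The measure of a double cap under an invariant measure only depends on its height. -/
theorem sphere_measure_abs_inner_ge {σ : Measure (Metric.sphere (0 : E) 1)}
    (hinv : ∀ f : E ≃ₗᵢ[ℝ] E, Measure.map (sphereMap f) σ = σ) {a : E} (ha : ‖a‖ = 1) (τ : ℝ)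
    {x : E} (hx : x ≠ 0) :
    σ {u : Metric.sphere (0 : E) 1 | τ * ‖x‖ ≤ |⟪(u : E), x⟫_ℝ|} =
      σ {u : Metric.sphere (0 : E) 1 | τ ≤ |⟪(u : E), a⟫_ℝ|} := by
  obtain ⟨f, hf⟩ := exists_linearIsometryEquiv_apply_eq (v := x) (w := ‖x‖ • a)
    (by simp [norm_smul, ha])
  conv_rhs => rw [← hinv f, Measure.map_apply (measurable_sphereMap f)
    (measurableSet_abs_inner_ge τ a)]
  congr 1
  ext u
  have hx' : 0 < ‖x‖ := norm_pos_iff.2 hx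
  have e : ⟪(u : E), x⟫_ℝ = ‖x‖ * ⟪f u, a⟫_ℝ := by
    rw [← f.inner_map_map, hf, real_inner_smul_right]
  simp only [Set.mem_preimage, Set.mem_ofPred_eq, sphereMap]
  rw [e, abs_mul, abs_norm, mul_comm, mul_le_mul_iff_right₀ hx']

theorem volume_ball_inter_cone_eq (τ : ℝ) {a b : E} (h : ‖a‖ = ‖b‖) :
    volume {x : E | ‖x‖ < 1 ∧ τ * ‖x‖ ≤ |⟪a, x⟫_ℝ|} =
      volume {x : E | ‖x‖ < 1 ∧ τ * ‖x‖ ≤ |⟪b, x⟫_ℝ|} := by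
  obtain ⟨f, hf⟩ := exists_linearIsometryEquiv_apply_eq h
  rw [← f.measurePreserving.measure_preimage_emb f.toMeasurableEquiv.measurableEmbedding
    {x : E | ‖x‖ < 1 ∧ τ * ‖x‖ ≤ |⟪b, x⟫_ℝ|}]
  simp [← hf]

/-- An invariant probability measure of a double cap, as a proportion of the volume of a ball. -/
theorem sphere_measure_abs_inner_ge_mul_volume_ball [Nontrivial E]
    {σ : Measure (Metric.sphere (0 : E) 1)} [IsProbabilityMeasure σ]
    (hinv : ∀ f : E ≃ₗᵢ[ℝ] E, Measure.map (sphereMap f) σ = σ) {a b : E} (ha : ‖a‖ = 1)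
    (hb : ‖b‖ = 1) (τ : ℝ) :
    σ {u : Metric.sphere (0 : E) 1 | τ ≤ |⟪(u : E), a⟫_ℝ|} * volume (Metric.ball (0 : E) 1) =
      volume {x : E | ‖x‖ < 1 ∧ τ * ‖x‖ ≤ |⟪b, x⟫_ℝ|} := by
  set ν : Measure E := volume.restrict (Metric.ball (0 : E) 1)
  have hS : MeasurableSet
      {p : Metric.sphere (0 : E) 1 × E | τ * ‖p.2‖ ≤ |⟪(p.1 : E), p.2⟫_ℝ|} :=
    measurableSet_le (by fun_prop) (by fun_prop)
  have h1 := Measure.prod_apply (μ := σ) (ν := ν) hS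
  rw [Measure.prod_apply_symm hS] at h1
  have h2 : ∀ᵐ x ∂ν, σ ((fun u ↦ (u, x)) ⁻¹'
      {p : Metric.sphere (0 : E) 1 × E | τ * ‖p.2‖ ≤ |⟪(p.1 : E), p.2⟫_ℝ|}) =
      σ {u : Metric.sphere (0 : E) 1 | τ ≤ |⟪(u : E), a⟫_ℝ|} :=
    ae_restrict_of_ae ((Measure.ae_ne volume (0 : E)).mono fun x hx ↦
      sphere_measure_abs_inner_ge hinv ha τ hx)
  have h3 : ∀ u : Metric.sphere (0 : E) 1, ν (Prod.mk u ⁻¹'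
      {p : Metric.sphere (0 : E) 1 × E | τ * ‖p.2‖ ≤ |⟪(p.1 : E), p.2⟫_ℝ|}) =
      volume {x : E | ‖x‖ < 1 ∧ τ * ‖x‖ ≤ |⟪b, x⟫_ℝ|} := by
    intro u
    rw [Measure.restrict_apply (measurable_prodMk_left hS), ← volume_ball_inter_cone_eq τ
      (a := (u : E)) (by simp [hb])]
    congr 1
    ext x
    simp [and_comm]
  rw [lintegral_congr_ae h2, lintegral_congr h3] at h1
  simpa [ν] using h1

end Rotation

/-- Lemma 2: the boundary-crossing probability of a uniformly sampled unit
direction against a linearized boundary with effective threshold `τ` equals the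
regularized incomplete beta value `I_{1-τ²}((m-1)/2, 1/2)`. -/
theorem sphere_cap_probability_incomplete_beta
    (m : ℕ) (hm : 2 ≤ m)
    (σ : Measure (Metric.sphere (0 : EuclideanSpace ℝ (Fin m)) 1))
    [IsProbabilityMeasure σ]
    (hinv : ∀ f : EuclideanSpace ℝ (Fin m) ≃ₗᵢ[ℝ] EuclideanSpace ℝ (Fin m),
      Measure.map (sphereMap f) σ = σ)
    (a : EuclideanSpace ℝ (Fin m)) (ha : ‖a‖ = 1)
    (τ : ℝ) (hτ : τ ∈ Set.Icc (0 : ℝ) 1) :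
    σ {u : Metric.sphere (0 : EuclideanSpace ℝ (Fin m)) 1 |
        τ ≤ |⟪(u : EuclideanSpace ℝ (Fin m)), a⟫_ℝ|} =
      ENNReal.ofReal
        ((∫ t in (0 : ℝ)..(1 - τ ^ 2),
            t ^ (((m : ℝ) - 3) / 2) * (1 - t) ^ (-(1 : ℝ) / 2)) /
          (Real.Gamma (((m : ℝ) - 1) / 2) * Real.Gamma (1 / 2) /
            Real.Gamma ((m : ℝ) / 2))) := by
  obtain ⟨n, rfl⟩ : ∃ n, m = n + 1 := ⟨m - 1, by omega⟩
  have hn : n ≠ 0 := by omega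
  have : NeZero n := ⟨hn⟩
  have hα : 0 < (((n + 1 : ℕ) : ℝ) - 1) / 2 := by
    have : 0 < (n : ℝ) := by positivity
    push_cast
    linarith
  have hβ : (0 : ℝ) < 1 / 2 := by norm_num
  have eα : (((n + 1 : ℕ) : ℝ) - 3) / 2 = (((n + 1 : ℕ) : ℝ) - 1) / 2 - 1 := by ring
  have eβ : -(1 : ℝ) / 2 = 1 / 2 - 1 := by norm_num
  have hB := ProbabilityTheory.beta_pos hα hβ
  have eB : Real.Gamma ((((n + 1 : ℕ) : ℝ) - 1) / 2) * Real.Gamma (1 / 2) /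
      Real.Gamma (((n + 1 : ℕ) : ℝ) / 2) =
      ProbabilityTheory.beta ((((n + 1 : ℕ) : ℝ) - 1) / 2) (1 / 2) := by
    rw [ProbabilityTheory.beta]
    congr 2
    ring
  obtain ⟨K, hK⟩ := volume_ball_inter_cone n
  have key : ∀ t ∈ Set.Icc (0 : ℝ) 1,
      2 * volume {x : EuclideanSpace ℝ (Fin (n + 1)) | ‖x‖ < 1 ∧ t * ‖x‖ ≤ |x 0|} =
      K * ENNReal.ofReal (∫ t in (0 : ℝ)..(1 - t ^ 2),
        t ^ ((((n + 1 : ℕ) : ℝ) - 1) / 2 - 1) * (1 - t) ^ ((1 : ℝ) / 2 - 1)) := by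
    intro t ht
    rw [hK t ht.1, mul_left_comm, lintegral_Ioi_eq_lintegral_beta hn, eα, eβ,
      lintegral_beta_integrand_Iic hα hβ (by nlinarith [ht.1, ht.2]) (by nlinarith [ht.1])]
  have key0 : 2 * volume (Metric.ball (0 : EuclideanSpace ℝ (Fin (n + 1))) 1) =
      K * ENNReal.ofReal (ProbabilityTheory.beta ((((n + 1 : ℕ) : ℝ) - 1) / 2) (1 / 2)) := by
    have h := key 0 (by simp)
    rw [← lintegral_beta_integrand_Iic hα hβ (by norm_num) (by norm_num)] at h
    rw [← lintegral_beta_integrand hα hβ]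
    convert h using 2
    · congr 1
      ext x
      simp
    · refine setLIntegral_congr_fun measurableSet_Ioo fun t ht ↦ ?_
      rw [Set.indicator_of_mem (by simpa using ht.2.le)]
  have hP := sphere_measure_abs_inner_ge_mul_volume_ball hinv ha
    (b := EuclideanSpace.single (0 : Fin (n + 1)) (1 : ℝ)) (by simp) τ
  simp only [EuclideanSpace.inner_single_left, map_one, one_mul] at hP
  have hV0 : volume (Metric.ball (0 : EuclideanSpace ℝ (Fin (n + 1))) 1) ≠ 0 :=
    (Metric.measure_ball_pos _ _ one_pos).ne'
  have hVt : volume (Metric.ball (0 : EuclideanSpace ℝ (Fin (n + 1))) 1) ≠ ⊤ :=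
    measure_ball_lt_top.ne
  rw [eα, eβ, eB, ENNReal.ofReal_div_of_pos hB]
  have hB0 := (ENNReal.ofReal_pos.2 hB).ne'
  have hK0 : K ≠ 0 := by
    rintro rfl
    simp [hV0] at key0
  have hKt : K ≠ ⊤ := by
    rintro rfl
    rw [ENNReal.top_mul hB0] at key0
    exact ENNReal.mul_ne_top (by simp) hVt key0
  rw [ENNReal.eq_div_iff hB0 ENNReal.ofReal_ne_top, ← ENNReal.mul_right_inj hK0 hKt, ← key τ hτ,
    ← mul_assoc, ← key0, ← hP, mul_assoc, mul_comm (volume _)]
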